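/- Let E be a set of n×n real orthogonal matrices. Then there exist finitely many real polynomials p₁, …, p_r in the n² matrix entries, each satisfying p_j(I) = 0 and the identity p_j(eX) = p_j(X) for all e ∈ E, such that the topological closure of the subgroup generated by E equals the common zero set {M : p₁(M) = 0, …, p_r(M) = 0}. -/

import Mathlib

/-- Evaluation of a real polynomial in the `n²` matrix entries at a matrix. -/
noncomputable def matEval {ι : Type} [Fintype ι] (M : Matrix ι ι ℝ)
    (p : MvPolynomial (ι × ι) ℝ) : ℝ :=
  MvPolynomial.eval (fun ij => M ij.1 ij.2) p

open MeasureTheory in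
/-- Integrating the left translates of a polynomial over a compact family of matrices yields a
polynomial. -/
lemma exists_matEval_eq_integral {ι : Type} [Fintype ι] {G : Type*} [TopologicalSpace G]
    [CompactSpace G] [MeasurableSpace G] [OpensMeasurableSpace G] (μ : Measure G)
    [IsFiniteMeasure μ] {ρ : G → Matrix ι ι ℝ} (hρ : Continuous ρ)
    (q : MvPolynomial (ι × ι) ℝ) :
    ∃ p : MvPolynomial (ι × ι) ℝ, ∀ X : Matrix ι ι ℝ,
      matEval X p = ∫ g, matEval (ρ g * X) q ∂μ := by
  classical
  let Q : MvPolynomial (ι × ι) C(G, ℝ) :=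
    MvPolynomial.eval₂Hom (MvPolynomial.C.comp (algebraMap ℝ C(G, ℝ)))
      (fun ij => ∑ k, MvPolynomial.C ⟨fun g => ρ g ij.1 k, hρ.matrix_elem _ _⟩ *
        MvPolynomial.X (k, ij.2)) q
  have evalQ (g : G) (X : Matrix ι ι ℝ) :
      ∑ m ∈ Q.support, Q.coeff m g * ∏ ij, X ij.1 ij.2 ^ m ij = matEval (ρ g * X) q := by
    let ev : C(G, ℝ) →+* ℝ := (Pi.evalRingHom (fun _ : G => ℝ) g).comp ContinuousMap.coeFnRingHom
    have h : MvPolynomial.eval₂Hom ev (fun ij => X ij.1 ij.2) Q = matEval (ρ g * X) q := by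
      rw [MvPolynomial.map_eval₂Hom, matEval, MvPolynomial.eval]
      congr 2
      · ext r
        simp [ev]
      · ext ij
        simp [ev, Matrix.mul_apply]
    rw [← h, MvPolynomial.coe_eval₂Hom, MvPolynomial.eval₂_eq']
    rfl
  refine ⟨∑ m ∈ Q.support, MvPolynomial.monomial m (∫ g, Q.coeff m g ∂μ), fun X => ?_⟩
  simp_rw [← evalQ]
  have integrable_coeff (m : ι × ι →₀ ℕ) : Integrable (fun g => Q.coeff m g) μ :=
    (Q.coeff m).continuous.integrable_of_hasCompactSupport
      (HasCompactSupport.of_compactSpace _)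
  rw [integral_finsetSum _ fun m _ => (integrable_coeff m).mul_const _, matEval, MvPolynomial.eval_sum]
  refine Finset.sum_congr rfl fun m _ => ?_
  rw [integral_mul_const, MvPolynomial.eval_monomial, Finsupp.prod_fintype _ _ (by simp)]

/-- Polynomials in the matrix entries approximate continuous functions uniformly on compact sets. -/
lemma exists_matEval_near_of_isCompact {ι : Type} [Fintype ι] (f : C(Matrix ι ι ℝ, ℝ))
    {K : Set (Matrix ι ι ℝ)} (hK : IsCompact K) {ε : ℝ} (hε : 0 < ε) :
    ∃ q : MvPolynomial (ι × ι) ℝ, ∀ X ∈ K, |matEval X q - f X| < ε := by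
  let entry (ij : ι × ι) : C(Matrix ι ι ℝ, ℝ) :=
    ⟨fun X => X ij.1 ij.2, continuous_id.matrix_elem _ _⟩
  let Φ : MvPolynomial (ι × ι) ℝ →ₐ[ℝ] C(Matrix ι ι ℝ, ℝ) := MvPolynomial.aeval entry
  have hΦ (q : MvPolynomial (ι × ι) ℝ) (X : Matrix ι ι ℝ) : Φ q X = matEval X q := by
    let ev : C(Matrix ι ι ℝ, ℝ) →ₐ[ℝ] ℝ := ContinuousMap.evalAlgHom ℝ ℝ X
    change (ev.comp Φ) q = _
    rw [MvPolynomial.comp_aeval, matEval, MvPolynomial.aeval_eq_eval]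
    rfl
  have hsep : Φ.range.SeparatesPoints := by
    intro X Y hXY
    obtain ⟨i, j, hij⟩ : ∃ i j, X i j ≠ Y i j := by
      by_contra! h
      exact hXY (Matrix.ext h)
    exact ⟨_, ⟨Φ (MvPolynomial.X (i, j)), ⟨_, rfl⟩, rfl⟩, by simpa [hΦ, matEval] using hij⟩
  obtain ⟨_, ⟨q, rfl⟩, hq⟩ :=
    ContinuousMap.exists_mem_subalgebra_near_continuous_of_isCompact_of_separatesPoints
      hsep f hK hε
  exact ⟨q, fun X hX => by simpa [hΦ] using hq X hX⟩

open MeasureTheory in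
/-- Invariant polynomials separate the image of a compact group of matrices from the matrices
outside it. -/
lemma exists_invariant_matEval_ne_zero {ι : Type} [Fintype ι] [DecidableEq ι] {G : Type*} [Group G]
    [TopologicalSpace G] [IsTopologicalGroup G] [CompactSpace G] (ρ : G →* Matrix ι ι ℝ)
    (hρ : Continuous ρ) {M : Matrix ι ι ℝ} (hM : M ∉ Set.range ρ) :
    ∃ p : MvPolynomial (ι × ι) ℝ, matEval 1 p = 0 ∧
      (∀ g X, matEval (ρ g * X) p = matEval X p) ∧ matEval M p ≠ 0 := by
  borelize G
  let μ : Measure G := Measure.haarMeasure ⊤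
  have : IsProbabilityMeasure μ := ⟨Measure.haarMeasure_self⟩
  have hs : IsCompact (Set.range ρ) := isCompact_range hρ
  have hρM : Continuous fun g => ρ g * M := hρ.matrix_mul continuous_const
  have ht : IsCompact (Set.range fun g => ρ g * M) := isCompact_range hρM
  have hd : Disjoint (Set.range ρ) (Set.range fun g => ρ g * M) := by
    rw [Set.disjoint_left]
    rintro _ ⟨g, rfl⟩ ⟨h, hh⟩
    refine hM ⟨h⁻¹ * g, ?_⟩
    rw [map_mul, ← hh, ← mul_assoc, ← map_mul, inv_mul_cancel, map_one, one_mul]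
  have : RegularSpace (Matrix ι ι ℝ) := inferInstanceAs (RegularSpace (ι → ι → ℝ))
  have : LocallyCompactSpace (Matrix ι ι ℝ) := inferInstanceAs (LocallyCompactSpace (ι → ι → ℝ))
  obtain ⟨f, hf0, hf1, -⟩ := exists_continuous_zero_one_of_isCompact hs ht.isClosed hd
  obtain ⟨q, hq⟩ := exists_matEval_near_of_isCompact f (hs.union ht)
    (by norm_num : (0 : ℝ) < 1 / 3)
  obtain ⟨p, hp⟩ := exists_matEval_eq_integral μ (hρ.comp continuous_inv) q
  simp only [Function.comp_apply] at hp
  have cont (X : Matrix ι ι ℝ) : Continuous fun g => matEval (ρ g⁻¹ * X) q := by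
    have : Continuous fun g => ρ g⁻¹ * X := (hρ.comp continuous_inv).matrix_mul continuous_const
    exact (MvPolynomial.continuous_eval q).comp
      (continuous_pi fun ij => this.matrix_elem ij.1 ij.2)
  have integrable_translate (X : Matrix ι ι ℝ) : Integrable (fun g => matEval (ρ g⁻¹ * X) q) μ :=
    (cont X).integrable_of_hasCompactSupport (HasCompactSupport.of_compactSpace _)
  have hinv (g : G) (X : Matrix ι ι ℝ) : matEval (ρ g * X) p = matEval X p := by
    rw [hp, hp, ← integral_mul_left_eq_self _ g]
    congr with h
    rw [← mul_assoc, ← map_mul]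
    simp
  have h1 : matEval 1 p ≤ 1 / 3 := by
    rw [hp]
    calc _ ≤ ∫ _ : G, (1 / 3 : ℝ) ∂μ := by
          refine integral_mono (integrable_translate 1) (integrable_const _) fun g => ?_
          have h := hq (ρ g⁻¹) (.inl ⟨_, rfl⟩)
          rw [hf0 ⟨_, rfl⟩, abs_lt] at h
          simp only [Pi.zero_apply, mul_one] at h ⊢
          linarith
      _ = 1 / 3 := by simp
  have h2 : 2 / 3 ≤ matEval M p := by
    rw [hp]
    calc (2 / 3 : ℝ) = ∫ _ : G, (2 / 3 : ℝ) ∂μ := by simp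
      _ ≤ _ := by
          refine integral_mono (integrable_const _) (integrable_translate M) fun g => ?_
          have h := hq (ρ g⁻¹ * M) (.inr ⟨_, rfl⟩)
          rw [hf1 ⟨_, rfl⟩, abs_lt] at h
          simp only [Pi.one_apply] at h ⊢
          linarith
  have hsub (X : Matrix ι ι ℝ) :
      matEval X (p - MvPolynomial.C (matEval 1 p)) = matEval X p - matEval 1 p := by
    simp [matEval]
  refine ⟨p - MvPolynomial.C (matEval 1 p), by rw [hsub, sub_self], fun g X => ?_, ?_⟩
  · rw [hsub, hsub, hinv]
  · rw [hsub]
    linarith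

/-- The common zero set of a family of polynomials is cut out by finitely many of them. -/
lemma exists_fin_matEval_zero_iff {ι : Type} [Fintype ι] (S : Set (MvPolynomial (ι × ι) ℝ)) :
    ∃ (r : ℕ) (p : Fin r → MvPolynomial (ι × ι) ℝ), (∀ j, p j ∈ S) ∧
      ∀ M, (∀ j, matEval M (p j) = 0) ↔ ∀ q ∈ S, matEval M q = 0 := by
  obtain ⟨T, hTS, hT⟩ := (Submodule.fg_span_iff_fg_span_finset_subset S).1
    (IsNoetherian.noetherian (Ideal.span S))
  refine ⟨T.card, fun j => T.equivFin.symm j, fun j => hTS (T.equivFin.symm j).2,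
    fun M => ⟨fun h q hq => ?_, fun h j => h _ (hTS (T.equivFin.symm j).2)⟩⟩
  have hker : Ideal.span (T : Set (MvPolynomial (ι × ι) ℝ)) ≤
      RingHom.ker (MvPolynomial.eval fun ij : ι × ι => M ij.1 ij.2) :=
    Ideal.span_le.2 fun t ht => by simpa [matEval] using h (T.equivFin ⟨t, ht⟩)
  exact hker (hT ▸ Submodule.subset_span hq : q ∈ Submodule.span _ _)

instance Matrix.compactSpace_orthogonalGroup {ι : Type*} [Fintype ι] [DecidableEq ι] :
    CompactSpace (Matrix.orthogonalGroup ι ℝ) := by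
  refine isCompact_iff_compactSpace.1 (IsCompact.of_isClosed_subset
    (isCompact_univ_pi fun _ : ι => isCompact_univ_pi fun _ : ι =>
      isCompact_Icc (a := (-1 : ℝ)) (b := 1)) (isClosed_unitary (R := Matrix ι ι ℝ)) ?_)
  intro U hU i _ j _
  exact abs_le.1 (entry_norm_bound_of_unitary hU i j)

/-- For a set `E` of orthogonal matrices there are finitely many polynomials
`p₁, …, p_r` in the matrix entries, each with `p_j(I) = 0` and `p_j(eX) = p_j(X)` for all
`e ∈ E`, whose common zero set is exactly the closure of the subgroup generated by `E`. -/
theorem closure_subgroup_eq_finite_zero_set {n : ℕ}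
    (E : Set (Matrix.orthogonalGroup (Fin n) ℝ)) :
    ∃ (r : ℕ) (p : Fin r → MvPolynomial (Fin n × Fin n) ℝ),
      (∀ j, matEval (1 : Matrix (Fin n) (Fin n) ℝ) (p j) = 0 ∧
        ∀ e ∈ E, ∀ X : Matrix (Fin n) (Fin n) ℝ,
          matEval ((e : Matrix (Fin n) (Fin n) ℝ) * X) (p j) = matEval X (p j)) ∧
      closure (Subtype.val '' (Subgroup.closure E : Set (Matrix.orthogonalGroup (Fin n) ℝ)))
        = {M : Matrix (Fin n) (Fin n) ℝ | ∀ j, matEval M (p j) = 0} := by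
  let K : Subgroup (Matrix.orthogonalGroup (Fin n) ℝ) := (Subgroup.closure E).topologicalClosure
  have hclosed : IsClosed (K : Set (Matrix.orthogonalGroup (Fin n) ℝ)) :=
    Subgroup.isClosed_topologicalClosure _
  have : CompactSpace K := isCompact_iff_compactSpace.1 hclosed.isCompact
  have hcl : closure (Subtype.val ''
      (Subgroup.closure E : Set (Matrix.orthogonalGroup (Fin n) ℝ))) =
      Subtype.val '' (K : Set (Matrix.orthogonalGroup (Fin n) ℝ)) :=
    isClosed_unitary.isClosedEmbedding_subtypeVal.closure_image_eq _
  let ρ : K →* Matrix (Fin n) (Fin n) ℝ :=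
    (Submonoid.subtype (Matrix.orthogonalGroup (Fin n) ℝ)).comp K.subtype
  have hρ : Continuous ρ := continuous_subtype_val.comp continuous_subtype_val
  obtain ⟨r, p, hp, hzero⟩ := exists_fin_matEval_zero_iff
    {q : MvPolynomial (Fin n × Fin n) ℝ | matEval (1 : Matrix (Fin n) (Fin n) ℝ) q = 0 ∧
      ∀ e ∈ E, ∀ X : Matrix (Fin n) (Fin n) ℝ,
        matEval ((e : Matrix (Fin n) (Fin n) ℝ) * X) q = matEval X q}
  refine ⟨r, p, hp, Set.Subset.antisymm ?_ fun M hM => ?_⟩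
  · refine closure_minimal ?_ ?_
    · rintro _ ⟨g, hg, rfl⟩ j
      have hinv : ∀ X : Matrix (Fin n) (Fin n) ℝ,
          matEval ((g : Matrix (Fin n) (Fin n) ℝ) * X) (p j) = matEval X (p j) := by
        induction hg using Subgroup.closure_induction with
        | mem e he => exact (hp j).2 e he
        | one => simp
        | mul a b _ _ ha hb => intro X; rw [Submonoid.coe_mul, mul_assoc, ha, hb]
        | inv a _ ha =>
          intro X
          rw [← ha, ← mul_assoc, ← Submonoid.coe_mul, mul_inv_cancel, Submonoid.coe_one, one_mul]
      simpa [(hp j).1] using hinv 1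
    · rw [Set.ofPred_forall]
      refine isClosed_iInter fun j => isClosed_singleton.preimage
        ((MvPolynomial.continuous_eval (p j)).comp
          (continuous_pi fun ij => continuous_id.matrix_elem ij.1 ij.2))
  · rw [hcl]
    by_contra hMK
    obtain ⟨q, hq1, hqinv, hqM⟩ := exists_invariant_matEval_ne_zero ρ hρ (M := M) (by
      rintro ⟨g, rfl⟩
      exact hMK ⟨g.1, g.2, rfl⟩)
    exact hqM ((hzero M).1 hM q ⟨hq1, fun e he X =>
      hqinv ⟨e, Subgroup.le_topologicalClosure _ (Subgroup.subset_closure he)⟩ X⟩)
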